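/- Let p be a regular Gaussian distribution on ℝ^N (equivalently a positive definite covariance matrix Σ). For distinct i, j, u and Z ⊆ V∖{i,j,u}: if i ⊥̸ u | Z and j ⊥̸ u | Z and i ⊥ j | Z∪{u}, then i ⊥̸ j | Z. -/

import Mathlib

/-- Conditional independence `i ⊥ j | Z` for a regular Gaussian with covariance
matrix `S`: the `(i,j)` entry of the inverse of the principal submatrix
`S_{ijZ,ijZ}` vanishes. -/
def CondIndep {V : Type*} [Fintype V] [DecidableEq V]
    (S : Matrix V V ℝ) (i j : V) (Z : Finset V)
    (hi : i ∈ insert i (insert j Z) := Finset.mem_insert_self i _)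
    (hj : j ∈ insert i (insert j Z) :=
      Finset.mem_insert_of_mem (Finset.mem_insert_self j Z)) : Prop :=
  ((S.submatrix (fun x : ↥(insert i (insert j Z)) => (x : V))
      (fun x : ↥(insert i (insert j Z)) => (x : V)))⁻¹) ⟨i, hi⟩ ⟨j, hj⟩ = 0

open Matrix in
/-- A positive definite matrix has no nonzero vector supported on `T` whose image vanishes
on `T`. -/
lemma eq_zero_of_mulVec_eq_zero_on {V : Type*} [Fintype V] {S : Matrix V V ℝ} (hS : S.PosDef)
    {T : Finset V} {w : V → ℝ} (hw : ∀ v ∉ T, w v = 0) (hSw : ∀ v ∈ T, (S *ᵥ w) v = 0) :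
    w = 0 := by
  by_contra hne
  have hpos := hS.dotProduct_mulVec_pos hne
  have hzero : star w ⬝ᵥ S *ᵥ w = 0 := by
    refine Finset.sum_eq_zero fun v _ => ?_
    by_cases hv : v ∈ T
    · rw [hSw v hv, mul_zero]
    · simp [hw v hv]
  exact hpos.ne' hzero

open Matrix in
/-- A column of the inverse of a principal submatrix, extended by zero. -/
lemma exists_extended_inv_column {V : Type*} [Fintype V] [DecidableEq V] {S : Matrix V V ℝ}
    (hS : S.PosDef) {T : Finset V} {a : V} (ha : a ∈ T) :
    ∃ y : V → ℝ, (∀ v ∉ T, y v = 0) ∧ (∀ v ∈ T, (S *ᵥ y) v = if v = a then 1 else 0) ∧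
      0 < y a ∧ ∀ v (hv : v ∈ T), y v =
        ((S.submatrix (fun x : ↥T => (x : V)) (fun x : ↥T => (x : V)))⁻¹) ⟨v, hv⟩ ⟨a, ha⟩ := by
  set N := S.submatrix (fun x : ↥T => (x : V)) (fun x : ↥T => (x : V)) with hN
  have hNpos : N.PosDef := hS.submatrix Subtype.val_injective
  refine ⟨fun v => if hv : v ∈ T then N⁻¹ ⟨v, hv⟩ ⟨a, ha⟩ else 0, fun v hv => dif_neg hv,
    fun v hv => ?_, ?_, fun v hv => dif_pos hv⟩
  · have hmul := congrFun (congrFun (Matrix.mul_nonsing_inv N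
      ((Matrix.isUnit_iff_isUnit_det N).mp hNpos.isUnit)) ⟨v, hv⟩) ⟨a, ha⟩
    rw [Matrix.mul_apply, Matrix.one_apply] at hmul
    simp only [Subtype.mk.injEq] at hmul
    rw [← hmul, Matrix.mulVec, dotProduct, ← Finset.sum_subset (Finset.subset_univ T)
      (fun x _ hx => by simp [hx]), ← Finset.sum_coe_sort T]
    exact Finset.sum_congr rfl fun x _ => by simp [hN]
  · simp only [ha, dif_pos]
    exact hNpos.inv.diag_pos

open Matrix in
/-- `r` is the residual of the coordinate `a` after regression on the coordinates in `Z`. -/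
structure IsResidual {V : Type*} [Fintype V] (S : Matrix V V ℝ) (Z : Finset V) (a : V)
    (r : V → ℝ) : Prop where
  apply_self : r a = 1
  apply_of_notMem : ∀ v, v ≠ a → v ∉ Z → r v = 0
  mulVec_of_mem : ∀ v ∈ Z, (S *ᵥ r) v = 0

namespace IsResidual

open Matrix

variable {V : Type*} [Fintype V] {S : Matrix V V ℝ} {Z : Finset V} {a b : V} {r s : V → ℝ}

lemma exists_of_posDef [DecidableEq V] (hS : S.PosDef) (ha : a ∉ Z) :
    ∃ r, IsResidual S Z a r := by
  obtain ⟨y, hy, hSy, hpos, -⟩ := exists_extended_inv_column hS (Finset.mem_insert_self a Z)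
  refine ⟨(y a)⁻¹ • y, by simp [hpos.ne'], fun v hva hv => by simp [hy v (by simp [hva, hv])],
    fun v hv => ?_⟩
  have hva : v ≠ a := ne_of_mem_of_not_mem hv ha
  simp [Matrix.mulVec_smul, hSy v (Finset.mem_insert_of_mem hv), hva]

/-- The partial covariance is the bilinear form evaluated at residuals. -/
lemma dotProduct_mulVec (hr : IsResidual S Z a r) (hs : IsResidual S Z b s) :
    r ⬝ᵥ S *ᵥ s = (S *ᵥ s) a := by
  rw [dotProduct, Finset.sum_eq_single a, hr.apply_self, one_mul]
  · intro v _ hva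
    by_cases hv : v ∈ Z
    · rw [hs.mulVec_of_mem v hv, mul_zero]
    · rw [hr.apply_of_notMem v hva hv, zero_mul]
  · exact fun h => absurd (Finset.mem_univ a) h

lemma mulVec_comm (hsymm : S.IsSymm) (hr : IsResidual S Z a r) (hs : IsResidual S Z b s) :
    (S *ᵥ s) a = (S *ᵥ r) b := by
  rw [← hr.dotProduct_mulVec hs, ← hs.dotProduct_mulVec hr, Matrix.dotProduct_mulVec,
    ← Matrix.mulVec_transpose, hsymm.eq, dotProduct_comm]

lemma mulVec_self_pos (hS : S.PosDef) (hr : IsResidual S Z a r) : 0 < (S *ᵥ r) a := by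
  have hne : r ≠ 0 := fun h => by simpa [h] using hr.apply_self
  simpa [hr.dotProduct_mulVec hr] using hS.dotProduct_mulVec_pos hne

/-- Residuals after regression on one further coordinate. -/
lemma insert [DecidableEq V] (hS : S.PosDef) (hr : IsResidual S Z a r)
    (hs : IsResidual S Z b s) (hab : a ≠ b) (ha : a ∉ Z) :
    IsResidual S (insert b Z) a (r - ((S *ᵥ r) b / (S *ᵥ s) b) • s) where
  apply_self := by simp [hr.apply_self, hs.apply_of_notMem a hab ha]
  apply_of_notMem v hva hv := by
    obtain ⟨hvb, hvZ⟩ : v ≠ b ∧ v ∉ Z := by simpa using hv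
    simp [hr.apply_of_notMem v hva hvZ, hs.apply_of_notMem v hvb hvZ]
  mulVec_of_mem v hv := by
    have hpos := hs.mulVec_self_pos hS
    rcases Finset.mem_insert.mp hv with rfl | hv
    · simp [Matrix.mulVec_sub, Matrix.mulVec_smul, hpos.ne']
    · simp [Matrix.mulVec_sub, Matrix.mulVec_smul, hr.mulVec_of_mem v hv, hs.mulVec_of_mem v hv]

lemma condIndep_iff [DecidableEq V] (hS : S.PosDef) (hr : IsResidual S Z b r) (hab : a ≠ b)
    (ha : a ∉ Z) (hb : b ∉ Z) : CondIndep S a b Z ↔ (S *ᵥ r) a = 0 := by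
  have hbT : b ∈ Insert.insert a (Insert.insert b Z) := by simp
  obtain ⟨y, hy, hSy, hpos, hinv⟩ := exists_extended_inv_column hS hbT
  have hSyZ : ∀ v ∈ Z, (S *ᵥ y) v = 0 := fun v hv => by
    rw [hSy v (by simp [hv]), if_neg (ne_of_mem_of_not_mem hv hb)]
  have hSya : (S *ᵥ y) a = 0 := by rw [hSy a (by simp), if_neg hab]
  rw [CondIndep, ← hinv a]
  constructor
  · intro hya
    have hzero : y - y b • r = 0 := by
      refine eq_zero_of_mulVec_eq_zero_on hS (T := Z) (fun v hv => ?_) fun v hv => ?_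
      · by_cases hvb : v = b
        · simp [hvb, hr.apply_self]
        · by_cases hva : v = a
          · simp [hva, hya, hr.apply_of_notMem a hab ha]
          · simp [hy v (by simp [hva, hvb, hv]), hr.apply_of_notMem v hvb hv]
      · simp [Matrix.mulVec_sub, Matrix.mulVec_smul, hSyZ v hv, hr.mulVec_of_mem v hv]
    rw [sub_eq_zero.mp hzero, Matrix.mulVec_smul] at hSya
    exact (mul_eq_zero.mp hSya).resolve_left hpos.ne'
  · intro hra
    have hzero : r - (S *ᵥ r) b • y = 0 := by
      refine eq_zero_of_mulVec_eq_zero_on hS (T := Insert.insert a (Insert.insert b Z))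
        (fun v hv => ?_) fun v hv => ?_
      · obtain ⟨-, hvb, hvZ⟩ : v ≠ a ∧ v ≠ b ∧ v ∉ Z := by simpa using hv
        simp [hy v hv, hr.apply_of_notMem v hvb hvZ]
      · rw [Matrix.mulVec_sub, Matrix.mulVec_smul, Pi.sub_apply, Pi.smul_apply, hSy v hv]
        rcases Finset.mem_insert.mp hv with rfl | hv
        · simp [hra, hab]
        · rcases Finset.mem_insert.mp hv with rfl | hv
          · simp
          · simp [hr.mulVec_of_mem v hv, ne_of_mem_of_not_mem hv hb]
    have hr_a := congrFun (sub_eq_zero.mp hzero) a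
    rw [hr.apply_of_notMem a hab ha] at hr_a
    exact (mul_eq_zero.mp hr_a.symm).resolve_left (hr.mulVec_self_pos hS).ne'

end IsResidual

/-- Weak transitivity (contrapositive form) for regular Gaussian distributions:
if `i ⊥̸ u | Z`, `j ⊥̸ u | Z` and `i ⊥ j | Z ∪ {u}`, then `i ⊥̸ j | Z`. -/
theorem gaussian_weak_transitivity_contrapositive {V : Type*} [Fintype V] [DecidableEq V]
    (S : Matrix V V ℝ) (hsymm : S.IsSymm) (hS : S.PosDef)
    (i j u : V) (hij : i ≠ j) (hiu : i ≠ u) (hju : j ≠ u)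
    (Z : Finset V) (hiZ : i ∉ Z) (hjZ : j ∉ Z) (huZ : u ∉ Z)
    (h1 : ¬ CondIndep S i u Z) (h2 : ¬ CondIndep S j u Z)
    (h3 : CondIndep S i j (insert u Z)) :
    ¬ CondIndep S i j Z := by
  intro h
  obtain ⟨r, hr⟩ := IsResidual.exists_of_posDef hS hjZ
  obtain ⟨s, hs⟩ := IsResidual.exists_of_posDef hS huZ
  rw [hs.condIndep_iff hS hiu hiZ huZ] at h1
  rw [hs.condIndep_iff hS hju hjZ huZ, hr.mulVec_comm hsymm hs] at h2
  rw [hr.condIndep_iff hS hij hiZ hjZ] at h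
  rw [(hr.insert hS hs hju hjZ).condIndep_iff hS hij (by simp [hiu, hiZ]) (by simp [hju, hjZ]),
    Matrix.mulVec_sub, Matrix.mulVec_smul, Pi.sub_apply, Pi.smul_apply, h, zero_sub,
    neg_eq_zero, smul_eq_mul] at h3
  exact mul_ne_zero (div_ne_zero h2 (hs.mulVec_self_pos hS).ne') h1 h3
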